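/- arXiv:2511.00112 — 10 statements merged into one kernel-verified Lean document; each statement's English description precedes it below -/
import Mathlib

section
/- Let Q be an n×n real positive definite matrix and let C̄ be an m×n real matrix. If the matrix I_m − C̄·Q·C̄ᵀ is positive definite, then the ellipsoid Ω = { s ∈ ℝⁿ : sᵀ·Q⁻¹·s < 1 } is contained in the set S = { s ∈ ℝⁿ : C̄·s < 1_m entrywise }, where 1_m is the all-ones vector. -/
open Matrix

/-- Young's inequality for the dual pair of quadratic forms of `Q` and `Q⁻¹`. -/
lemma Matrix.PosDef.two_mul_dotProduct_le {ι : Type*} [Fintype ι] [DecidableEq ι]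
    {Q : Matrix ι ι ℝ} (hQ : Q.PosDef) (c s : ι → ℝ) :
    2 * (c ⬝ᵥ s) ≤ s ⬝ᵥ (Q⁻¹ *ᵥ s) + c ⬝ᵥ (Q *ᵥ c) := by
  have hdet : IsUnit Q.det := (Q.isUnit_iff_isUnit_det).mp hQ.isUnit
  have hcancel : Q⁻¹ *ᵥ (Q *ᵥ c) = c := by
    rw [mulVec_mulVec, nonsing_inv_mul _ hdet, one_mulVec]
  have hsymm : Qᵀ = Q := by simpa using hQ.isHermitian.eq
  have hcross : (Q *ᵥ c) ⬝ᵥ (Q⁻¹ *ᵥ s) = c ⬝ᵥ s := by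
    rw [← vecMul_transpose, hsymm, ← dotProduct_mulVec, mulVec_mulVec,
      mul_nonsing_inv _ hdet, one_mulVec]
  have hnonneg := hQ.inv.posSemidef.dotProduct_mulVec_nonneg (s - Q *ᵥ c)
  simp only [star_trivial, mulVec_sub, hcancel, dotProduct_sub, sub_dotProduct, hcross] at hnonneg
  rw [dotProduct_comm s c, dotProduct_comm (Q *ᵥ c) c] at hnonneg
  linarith

/-- If `I - C̄ Q C̄ᵀ ≻ 0` with `Q ≻ 0`, then the ellipsoid
`{s | sᵀ Q⁻¹ s < 1}` is contained in `{s | C̄ s < 1 entrywise}`. -/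
theorem ellipsoid_subset_of_posDef {n m : ℕ}
    (Q : Matrix (Fin n) (Fin n) ℝ) (hQ : Q.PosDef)
    (Cbar : Matrix (Fin m) (Fin n) ℝ)
    (h : ((1 : Matrix (Fin m) (Fin m) ℝ) - Cbar * Q * Cbarᵀ).PosDef) :
    {s : Fin n → ℝ | s ⬝ᵥ (Q⁻¹ *ᵥ s) < 1} ⊆
      {s : Fin n → ℝ | ∀ i, (Cbar *ᵥ s) i < 1} := by
  intro s hs i
  have hs' : s ⬝ᵥ (Q⁻¹ *ᵥ s) < 1 := hs
  have hdiag : 0 < 1 - (Cbar * Q * Cbarᵀ) i i := by simpa using h.diag_pos (i := i)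
  have hrow : (Cbar * Q * Cbarᵀ) i i = Cbar i ⬝ᵥ (Q *ᵥ Cbar i) := by
    rw [Matrix.mul_assoc]
    rfl
  have hyoung := hQ.two_mul_dotProduct_le (Cbar i) s
  change Cbar i ⬝ᵥ s < 1
  linarith
end

section
/- Let T be an m×m real positive definite matrix and let D̄ be a p×m real matrix. If the matrix I_p − D̄·T·D̄ᵀ is positive definite, then the ellipsoid Ξ = { a ∈ ℝᵐ : aᵀ·T⁻¹·a < 1 } is contained in the set A = { a ∈ ℝᵐ : D̄·a < 1_p entrywise }, where 1_p is the all-ones vector. -/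
open Matrix

/-- If `I - D̄ T D̄ᵀ ≻ 0` with `T ≻ 0`, then the ellipsoid
`{a | aᵀ T⁻¹ a < 1}` is contained in `{a | D̄ a < 1 entrywise}`. -/
theorem action_ellipsoid_subset_of_posDef {m p : ℕ}
    (T : Matrix (Fin m) (Fin m) ℝ) (hT : T.PosDef)
    (Dbar : Matrix (Fin p) (Fin m) ℝ)
    (h : ((1 : Matrix (Fin p) (Fin p) ℝ) - Dbar * T * Dbarᵀ).PosDef) :
    {a : Fin m → ℝ | a ⬝ᵥ (T⁻¹ *ᵥ a) < 1} ⊆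
      {a : Fin m → ℝ | ∀ i, (Dbar *ᵥ a) i < 1} := by
  intro a ha i
  simp only [Set.mem_ofPred_eq] at ha
  have hdet : IsUnit T.det := (isUnit_iff_isUnit_det T).mp hT.isUnit
  have hsymm : Tᵀ = T := by simpa using hT.isHermitian.eq
  have hrow : Dbar i ⬝ᵥ (T *ᵥ Dbar i) < 1 := by
    have hdiag := h.diag_pos (i := i)
    have hentry : (Dbar * T * Dbarᵀ) i i = Dbar i ⬝ᵥ (T *ᵥ Dbar i) := by
      rw [Matrix.mul_assoc]
      rfl
    rw [Matrix.sub_apply, one_apply_eq, hentry] at hdiag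
    linarith
  have hnonneg := hT.inv.posSemidef.dotProduct_mulVec_nonneg (a - T *ᵥ Dbar i)
  have hcancel : T⁻¹ *ᵥ (T *ᵥ Dbar i) = Dbar i := by
    rw [mulVec_mulVec, nonsing_inv_mul T hdet, one_mulVec]
  have hcross : (T *ᵥ Dbar i) ⬝ᵥ (T⁻¹ *ᵥ a) = Dbar i ⬝ᵥ a := by
    rw [← vecMul_transpose, hsymm, ← dotProduct_mulVec, mulVec_mulVec, mul_nonsing_inv T hdet,
      one_mulVec]
  rw [star_trivial, mulVec_sub, hcancel, sub_dotProduct, dotProduct_sub, dotProduct_sub, hcross,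
    dotProduct_comm a (Dbar i), dotProduct_comm (T *ᵥ Dbar i) (Dbar i)] at hnonneg
  change Dbar i ⬝ᵥ a < 1
  linarith
end

section
/- Let C be a p×n real matrix, let c ∈ ℝᵖ be a vector with all entries strictly positive, and let P be an n×n real positive definite matrix. If the matrix I_p − (C·diag(c)⁻¹)·P⁻¹·(C·diag(c)⁻¹)ᵀ is positive definite, then the ellipsoid { s ∈ ℝⁿ : sᵀ·P·s < 1 } is contained in the safety set S = { s ∈ ℝⁿ : −c < C·s < c entrywise }. -/
open Matrix

/-- The Cauchy-Schwarz inequality for a real positive semidefinite matrix. -/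
theorem Matrix.PosSemidef.sq_dotProduct_mulVec_le {ι : Type*} [Fintype ι]
    {P : Matrix ι ι ℝ} (hP : P.PosSemidef) (x y : ι → ℝ) :
    (x ⬝ᵥ (P *ᵥ y)) ^ 2 ≤ (x ⬝ᵥ (P *ᵥ x)) * (y ⬝ᵥ (P *ᵥ y)) := by
  have hsymm : y ⬝ᵥ (P *ᵥ x) = x ⬝ᵥ (P *ᵥ y) := by
    rw [dotProduct_mulVec, ← mulVec_transpose, dotProduct_comm,
      show Pᵀ = P from hP.isHermitian]
  have hquad : ∀ t : ℝ,
      0 ≤ (x ⬝ᵥ (P *ᵥ x)) * (t * t) + 2 * (x ⬝ᵥ (P *ᵥ y)) * t + y ⬝ᵥ (P *ᵥ y) := fun t ↦ by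
    have ht := hP.dotProduct_mulVec_nonneg (t • x + y)
    simp only [star_trivial, mulVec_add, mulVec_smul, dotProduct_add, add_dotProduct,
      smul_dotProduct, dotProduct_smul, smul_eq_mul, hsymm] at ht
    linarith
  have hdiscrim := discrim_le_zero hquad
  rw [discrim] at hdiscrim
  linarith

/-- The Cauchy-Schwarz inequality pairing the quadratic forms of `P⁻¹` and `P`. -/
theorem Matrix.PosDef.sq_dotProduct_le {ι : Type*} [Fintype ι] [DecidableEq ι]
    {P : Matrix ι ι ℝ} (hP : P.PosDef) (x y : ι → ℝ) :
    (x ⬝ᵥ y) ^ 2 ≤ (x ⬝ᵥ (P⁻¹ *ᵥ x)) * (y ⬝ᵥ (P *ᵥ y)) := by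
  have hdet : IsUnit P.det := hP.det_pos.ne'.isUnit
  have hx : P *ᵥ (P⁻¹ *ᵥ x) = x := by
    rw [mulVec_mulVec, mul_nonsing_inv P hdet, one_mulVec]
  have hxy : (P⁻¹ *ᵥ x) ⬝ᵥ (P *ᵥ y) = x ⬝ᵥ y := by
    rw [dotProduct_mulVec, ← mulVec_transpose, show Pᵀ = P from hP.isHermitian, hx]
  have hcs := hP.posSemidef.sq_dotProduct_mulVec_le (P⁻¹ *ᵥ x) y
  rwa [hxy, hx, dotProduct_comm (P⁻¹ *ᵥ x)] at hcs

/-- If `I - (C diag(c)⁻¹) P⁻¹ (C diag(c)⁻¹)ᵀ ≻ 0` with `P ≻ 0` and `c > 0` entrywise,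
then the ellipsoid `{s | sᵀ P s < 1}` is contained in the safety set
`{s | -c < C s < c entrywise}`. -/
theorem ellipsoid_subset_safety_set {p n : ℕ}
    (C : Matrix (Fin p) (Fin n) ℝ) (c : Fin p → ℝ) (hc : ∀ i, 0 < c i)
    (P : Matrix (Fin n) (Fin n) ℝ) (hP : P.PosDef)
    (h : ((1 : Matrix (Fin p) (Fin p) ℝ) -
        ((Matrix.diagonal c)⁻¹ * C) * P⁻¹ * ((Matrix.diagonal c)⁻¹ * C)ᵀ).PosDef) :
    {s : Fin n → ℝ | s ⬝ᵥ (P *ᵥ s) < 1} ⊆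
      {s : Fin n → ℝ | ∀ i, -c i < (C *ᵥ s) i ∧ (C *ᵥ s) i < c i} := by
  intro s hs i
  rw [Set.mem_ofPred_eq] at hs
  set M := (diagonal c)⁻¹ * C with hM
  have hrow : (M * P⁻¹ * Mᵀ) i i = M i ⬝ᵥ (P⁻¹ *ᵥ M i) := by
    rw [Matrix.mul_assoc]
    rfl
  have hdiag : M i ⬝ᵥ (P⁻¹ *ᵥ M i) < 1 := by
    have hpos := h.diag_pos (i := i)
    rw [Matrix.sub_apply, one_apply_eq, hrow] at hpos
    linarith
  have hs0 : 0 ≤ s ⬝ᵥ (P *ᵥ s) := by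
    simpa using hP.posSemidef.dotProduct_mulVec_nonneg s
  have hsq : (M i ⬝ᵥ s) ^ 2 < 1 := by
    nlinarith [hP.sq_dotProduct_le (M i) s]
  have hCM : (C *ᵥ s) i = c i * (M i ⬝ᵥ s) := by
    have hunit : IsUnit (diagonal c).det := by
      rw [det_diagonal]
      exact (Finset.prod_pos fun j _ ↦ hc j).ne'.isUnit
    have hC : C = diagonal c * M := by
      rw [hM, ← Matrix.mul_assoc, mul_nonsing_inv _ hunit, Matrix.one_mul]
    conv_lhs => rw [hC, ← mulVec_mulVec, mulVec_diagonal]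
    rfl
  obtain ⟨hlo, hhi⟩ := abs_lt.mp ((sq_lt_one_iff_abs_lt_one _).mp hsq)
  rw [hCM]
  constructor <;> nlinarith [hc i]
end

section
/- Let Q be an n×n real positive definite matrix, A an n×n real matrix, B an n×m real matrix, R an m×n real matrix, and let α > 0 and φ > 0 be reals. Set P = Q⁻¹, F = R·Q⁻¹, and Ā = A + B·F. Then the 2n×2n block matrix [[α·Q, Q·Aᵀ + Rᵀ·Bᵀ], [A·Q + B·R, Q/(1+φ)]] is positive definite if and only if α·P − (1+φ)·Āᵀ·P·Ā is positive definite. -/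
open Matrix

namespace Matrix

variable {l k 𝕜 : Type*} [Fintype l] [Fintype k]

theorem posDef_fromBlocks_zero_iff [Ring 𝕜] [PartialOrder 𝕜] [IsOrderedAddMonoid 𝕜] [StarRing 𝕜]
    {A : Matrix l l 𝕜} {D : Matrix k k 𝕜} :
    (fromBlocks A 0 0 D).PosDef ↔ A.PosDef ∧ D.PosDef := by
  refine ⟨fun h => ⟨?_, ?_⟩, fun ⟨hA, hD⟩ => ?_⟩
  · exact h.submatrix Sum.inl_injective
  · exact h.submatrix Sum.inr_injective
  · refine .of_dotProduct_mulVec_pos (.fromBlocks hA.1 (by simp) hD.1) fun x hx => ?_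
    obtain ⟨u, v, rfl⟩ : ∃ u v, x = Sum.elim u v := ⟨_, _, (Sum.elim_comp_inl_inr x).symm⟩
    have key : star (Sum.elim u v) ⬝ᵥ (fromBlocks A 0 0 D *ᵥ Sum.elim u v) =
        star u ⬝ᵥ (A *ᵥ u) + star v ⬝ᵥ (D *ᵥ v) := by
      simp [fromBlocks_mulVec, dotProduct_block, Function.comp_def, Pi.star_def]
    rw [key]
    by_cases hu : u = 0
    · have hv : v ≠ 0 := by
        rintro rfl
        exact hx (by simp [hu])
      simpa [hu] using hD.dotProduct_mulVec_pos hv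
    · exact add_pos_of_pos_of_nonneg (hA.dotProduct_mulVec_pos hu)
        (hD.posSemidef.dotProduct_mulVec_nonneg v)

/-- A block matrix with positive definite lower-right block is positive definite if and only if the
Schur complement of that block is. -/
theorem posDef_fromBlocks_iff_posDef_schur₂₂ [DecidableEq l] [DecidableEq k] [Field 𝕜]
    [PartialOrder 𝕜] [IsOrderedAddMonoid 𝕜] [StarRing 𝕜] (A : Matrix l l 𝕜) (C : Matrix k l 𝕜)
    {D : Matrix k k 𝕜} (hD : D.PosDef) :
    (fromBlocks A Cᴴ C D).PosDef ↔ (A - Cᴴ * D⁻¹ * C).PosDef := by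
  have hdet : IsUnit D.det := (isUnit_iff_isUnit_det D).1 hD.isUnit
  have hU : IsUnit (fromBlocks 1 0 (D⁻¹ * C) 1 : Matrix (l ⊕ k) (l ⊕ k) 𝕜) :=
    isUnit_fromBlocks_zero₁₂.2 ⟨isUnit_one, isUnit_one⟩
  have hfactor : fromBlocks A Cᴴ C D = star (fromBlocks 1 0 (D⁻¹ * C) 1) *
      fromBlocks (A - Cᴴ * D⁻¹ * C) 0 0 D * fromBlocks 1 0 (D⁻¹ * C) 1 := by
    simp [star_eq_conjTranspose, fromBlocks_conjTranspose, fromBlocks_multiply,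
      hD.isHermitian.inv.eq, Matrix.mul_assoc, nonsing_inv_mul _ hdet,
      mul_nonsing_inv_cancel_left _ _ hdet]
  rw [hfactor, hU.posDef_star_left_conjugate_iff, posDef_fromBlocks_zero_iff,
    and_iff_left hD]

end Matrix

/-- Schur-complement characterization: the block matrix
`[[α Q, Q Aᵀ + Rᵀ Bᵀ], [A Q + B R, Q/(1+φ)]]` is positive definite iff
`α P - (1+φ) Āᵀ P Ā ≻ 0`, where `P = Q⁻¹`, `F = R Q⁻¹`, `Ā = A + B F`. -/
theorem blockMatrix_posDef_iff {n m : ℕ}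
    (Q : Matrix (Fin n) (Fin n) ℝ) (hQ : Q.PosDef)
    (A : Matrix (Fin n) (Fin n) ℝ) (B : Matrix (Fin n) (Fin m) ℝ)
    (R : Matrix (Fin m) (Fin n) ℝ) (α φ : ℝ) (hα : 0 < α) (hφ : 0 < φ) :
    (Matrix.fromBlocks (α • Q) (Q * Aᵀ + Rᵀ * Bᵀ) (A * Q + B * R)
        ((1 + φ)⁻¹ • Q)).PosDef ↔
      (α • Q⁻¹ -
        (1 + φ) • ((A + B * (R * Q⁻¹))ᵀ * Q⁻¹ * (A + B * (R * Q⁻¹)))).PosDef := by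
  have hφ' : 0 < 1 + φ := by positivity
  have hdet : IsUnit Q.det := (isUnit_iff_isUnit_det Q).1 hQ.isUnit
  have hQT : Qᵀ = Q := by simpa using hQ.isHermitian.eq
  set G := A + B * (R * Q⁻¹) with hG
  have hGQ : A * Q + B * R = G * Q := by
    simp [hG, Matrix.add_mul, Matrix.mul_assoc, nonsing_inv_mul _ hdet]
  have hGQT : Q * Aᵀ + Rᵀ * Bᵀ = (G * Q)ᴴ := by
    simp [← hGQ, hQT]
  have hinv : ((1 + φ)⁻¹ • Q)⁻¹ = (1 + φ) • Q⁻¹ := by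
    apply inv_eq_left_inv
    simp [smul_smul, nonsing_inv_mul _ hdet, hφ'.ne']
  have hschur : α • Q - (G * Q)ᴴ * ((1 + φ) • Q⁻¹) * (G * Q) =
      star Q * (α • Q⁻¹ - (1 + φ) • (Gᵀ * Q⁻¹ * G)) * Q := by
    simp [star_eq_conjTranspose, hQT, Matrix.mul_sub, Matrix.sub_mul, Matrix.mul_assoc,
      nonsing_inv_mul _ hdet]
  rw [hGQ, hGQT, posDef_fromBlocks_iff_posDef_schur₂₂ _ _ (hQ.smul (inv_pos.2 hφ')), hinv, hschur,
    hQ.isUnit.posDef_star_left_conjugate_iff]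
end

section
/- Let Q be an n×n real positive definite matrix and let s ∈ ℝⁿ. If the matrix Q − n·diag(s)·diag(s) is positive definite, then sᵀ·Q⁻¹·s < 1. -/
open Matrix

/-- If `Q - n diag(s) diag(s) ≻ 0` with `Q ≻ 0`, then `sᵀ Q⁻¹ s < 1`. -/
theorem quadratic_lt_one_of_posDef {n : ℕ}
    (Q : Matrix (Fin n) (Fin n) ℝ) (hQ : Q.PosDef) (s : Fin n → ℝ)
    (h : (Q - (n : ℝ) • (Matrix.diagonal s * Matrix.diagonal s)).PosDef) :
    s ⬝ᵥ (Q⁻¹ *ᵥ s) < 1 := by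
  have hdet : IsUnit Q.det := (Matrix.isUnit_iff_isUnit_det Q).mp hQ.isUnit
  have hQx : Q *ᵥ (Q⁻¹ *ᵥ s) = s := by
    rw [mulVec_mulVec, mul_nonsing_inv _ hdet, one_mulVec]
  generalize Q⁻¹ *ᵥ s = x at hQx ⊢
  by_cases hx : x = 0
  · simp [hx]
  have hpos := h.dotProduct_mulVec_pos hx
  have hdiag : x ⬝ᵥ ((diagonal s * diagonal s) *ᵥ x) = ∑ i, (s i * x i) ^ 2 := by
    simp only [diagonal_mul_diagonal, dotProduct, mulVec_diagonal]
    exact Finset.sum_congr rfl fun i _ => by ring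
  rw [star_trivial, sub_mulVec, dotProduct_sub, hQx, smul_mulVec, dotProduct_smul, hdiag,
    smul_eq_mul, dotProduct_comm] at hpos
  have hcs : (s ⬝ᵥ x) ^ 2 ≤ n * ∑ i, (s i * x i) ^ 2 := by
    simpa [dotProduct] using
      sq_sum_le_card_mul_sum_sq (s := Finset.univ) (f := fun i => s i * x i)
  nlinarith [hpos, hcs]
end

section
/- Let P be an n×n real positive definite matrix, Ā an n×n real matrix, and let α ∈ (0,1), φ > 0, κ > 0 be reals. Suppose α·P − (1+φ)·Āᵀ·P·Ā is positive definite. Then for any e, h ∈ ℝⁿ with hᵀ·P·h ≤ κ, the vector e⁺ = Ā·e + h satisfies (e⁺)ᵀ·P·e⁺ < α·eᵀ·P·e + (φ+1)·κ/φ. -/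
open Matrix

/-- Young's inequality for the quadratic form of a positive semidefinite matrix. -/
theorem quadForm_add_le_young {n : Type*} [Fintype n] {P : Matrix n n ℝ} (hP : P.PosSemidef)
    {φ : ℝ} (hφ : 0 < φ) (x y : n → ℝ) :
    (x + y) ⬝ᵥ (P *ᵥ (x + y)) ≤
      (1 + φ) * (x ⬝ᵥ (P *ᵥ x)) + (φ + 1) * (y ⬝ᵥ (P *ᵥ y)) / φ := by
  have key : 0 ≤ (φ • x - y) ⬝ᵥ (P *ᵥ (φ • x - y)) := by
    simpa using hP.dotProduct_mulVec_nonneg (φ • x - y)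
  simp only [mulVec_sub, mulVec_smul, sub_dotProduct, dotProduct_sub, smul_dotProduct,
    dotProduct_smul, smul_eq_mul] at key
  simp only [mulVec_add, add_dotProduct, dotProduct_add]
  rw [← sub_le_iff_le_add', le_div_iff₀ hφ]
  linarith

/-- One-step Lyapunov decrease with bounded mismatch: if
`α P - (1+φ) Āᵀ P Ā ≻ 0` and `hᵀ P h ≤ κ`, then for `e⁺ = Ā e + h` we have
`(e⁺)ᵀ P e⁺ < α eᵀ P e + (φ+1) κ / φ`. -/
theorem one_step_lyapunov_decrease {n : ℕ}
    (P : Matrix (Fin n) (Fin n) ℝ) (hP : P.PosDef)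
    (Abar : Matrix (Fin n) (Fin n) ℝ) (α φ κ : ℝ)
    (hα : α ∈ Set.Ioo (0 : ℝ) 1) (hφ : 0 < φ) (hκ : 0 < κ)
    (hLMI : (α • P - (1 + φ) • (Abarᵀ * P * Abar)).PosDef)
    (e h : Fin n → ℝ) (hh : h ⬝ᵥ (P *ᵥ h) ≤ κ) :
    (Abar *ᵥ e + h) ⬝ᵥ (P *ᵥ (Abar *ᵥ e + h)) <
      α * (e ⬝ᵥ (P *ᵥ e)) + (φ + 1) * κ / φ := by
  have young := quadForm_add_le_young hP.posSemidef hφ (Abar *ᵥ e) h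
  have hle : (φ + 1) * (h ⬝ᵥ (P *ᵥ h)) / φ ≤ (φ + 1) * κ / φ := by gcongr
  rcases eq_or_ne e 0 with rfl | he
  · have hlt : κ < (φ + 1) * κ / φ := by
      rw [lt_div_iff₀ hφ]
      linarith
    simpa using hh.trans_lt hlt
  · have hpos := hLMI.dotProduct_mulVec_pos he
    have hquad : e ⬝ᵥ ((Abarᵀ * P * Abar) *ᵥ e) = (Abar *ᵥ e) ⬝ᵥ (P *ᵥ (Abar *ᵥ e)) := by
      rw [← mulVec_mulVec, ← mulVec_mulVec, dotProduct_mulVec, vecMul_transpose]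
    simp only [star_trivial, sub_mulVec, smul_mulVec, dotProduct_sub, dotProduct_smul,
      smul_eq_mul, hquad] at hpos
    linarith
end

section
/- Let P be an n×n real positive definite matrix, Ā an n×n real matrix, h : ℝⁿ → ℝⁿ a function, and let α ∈ (0,1), φ > 0, κ > 0 be reals satisfying α + (φ+1)·κ/φ ≤ 1. Suppose α·P − (1+φ)·Āᵀ·P·Ā is positive definite and h(e)ᵀ·P·h(e) ≤ κ for every e ∈ ℝⁿ with eᵀ·P·e ≤ 1. If the sequence e : ℕ → ℝⁿ satisfies e(t+1) = Ā·e(t) + h(e(t)) for all t and e(0)ᵀ·P·e(0) < 1, then e(t)ᵀ·P·e(t) < 1 for all t ∈ ℕ. -/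
open Matrix

/-- Young's inequality for the quadratic form of a positive semidefinite matrix. -/
theorem Matrix.PosSemidef.dotProduct_mulVec_add_le {ι : Type*} [Fintype ι]
    {P : Matrix ι ι ℝ} (hP : P.PosSemidef) {φ : ℝ} (hφ : 0 < φ) (u w : ι → ℝ) :
    (u + w) ⬝ᵥ (P *ᵥ (u + w)) ≤
      (1 + φ) * (u ⬝ᵥ (P *ᵥ u)) + (φ + 1) / φ * (w ⬝ᵥ (P *ᵥ w)) := by
  have hnonneg := hP.dotProduct_mulVec_nonneg (φ • u - w)
  simp only [star_trivial, mulVec_sub, mulVec_smul, dotProduct_sub, sub_dotProduct,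
    smul_dotProduct, dotProduct_smul, smul_eq_mul] at hnonneg
  simp only [mulVec_add, dotProduct_add, add_dotProduct]
  refine le_of_sub_nonneg ((div_nonneg hnonneg hφ.le).trans_eq ?_)
  field_simp
  ring

/-- The quadratic form of a congruence `Aᵀ * P * A` is that of `P` along `A`. -/
theorem Matrix.dotProduct_transpose_mul_mul_mulVec {m ι : Type*} [Fintype m] [Fintype ι]
    (P : Matrix m m ℝ) (A : Matrix m ι ℝ) (x : ι → ℝ) :
    x ⬝ᵥ ((Aᵀ * P * A) *ᵥ x) = (A *ᵥ x) ⬝ᵥ (P *ᵥ (A *ᵥ x)) := by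
  rw [Matrix.mul_assoc, ← mulVec_mulVec, ← mulVec_mulVec, dotProduct_mulVec, vecMul_transpose]

/-- Forward invariance of the unit ellipsoid of `P` for the closed-loop error
dynamics `e(t+1) = Ā e(t) + h(e(t))` with bounded mismatch `h`. -/
theorem unit_ellipsoid_forward_invariant {n : ℕ}
    (P : Matrix (Fin n) (Fin n) ℝ) (hP : P.PosDef)
    (Abar : Matrix (Fin n) (Fin n) ℝ) (h : (Fin n → ℝ) → (Fin n → ℝ))
    (α φ κ : ℝ) (hα : α ∈ Set.Ioo (0 : ℝ) 1) (hφ : 0 < φ) (hκ : 0 < κ)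
    (hsum : α + (φ + 1) * κ / φ ≤ 1)
    (hLMI : (α • P - (1 + φ) • (Abarᵀ * P * Abar)).PosDef)
    (hh : ∀ e : Fin n → ℝ, e ⬝ᵥ (P *ᵥ e) ≤ 1 → (h e) ⬝ᵥ (P *ᵥ (h e)) ≤ κ)
    (e : ℕ → Fin n → ℝ) (hdyn : ∀ t, e (t + 1) = Abar *ᵥ e t + h (e t))
    (h0 : (e 0) ⬝ᵥ (P *ᵥ (e 0)) < 1) :
    ∀ t : ℕ, (e t) ⬝ᵥ (P *ᵥ (e t)) < 1 := by
  intro t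
  induction t with
  | zero => exact h0
  | succ t ih =>
    have hyoung := hP.posSemidef.dotProduct_mulVec_add_le hφ (Abar *ᵥ e t) (h (e t))
    have hcontract := hLMI.posSemidef.dotProduct_mulVec_nonneg (e t)
    simp only [star_trivial, sub_mulVec, smul_mulVec, dotProduct_sub, dotProduct_smul,
      smul_eq_mul, dotProduct_transpose_mul_mul_mulVec] at hcontract
    have hmismatch := mul_le_mul_of_nonneg_left (hh (e t) ih.le)
      (by positivity : 0 ≤ (φ + 1) / φ)
    have hstrict := mul_lt_mul_of_pos_left ih hα.1
    rw [mul_div_right_comm] at hsum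
    rw [hdyn]
    linarith
end

section
/- Let P be an n×n real positive definite matrix, Ā an n×n real matrix, h : ℝⁿ → ℝⁿ a function, and let α ∈ (0,1), φ > 0, κ > 0, b > 0 be reals satisfying α + (φ+1)·κ/φ ≤ 1 and (φ+1)·κ/((1−α)·φ) < b. Suppose α·P − (1+φ)·Āᵀ·P·Ā is positive definite and h(e)ᵀ·P·h(e) ≤ κ for every e ∈ ℝⁿ with eᵀ·P·e ≤ 1. If the sequence e : ℕ → ℝⁿ satisfies e(t+1) = Ā·e(t) + h(e(t)) for all t and e(0)ᵀ·P·e(0) < 1, then there exists τ ∈ ℕ such that e(τ)ᵀ·P·e(τ) < b. -/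
open Matrix

/-- Young's inequality for the quadratic form of a positive semidefinite matrix. -/
theorem Matrix.PosSemidef.quadratic_add_le {ι : Type*} [Fintype ι] {P : Matrix ι ι ℝ}
    (hP : P.PosSemidef) {φ : ℝ} (hφ : 0 < φ) (x y : ι → ℝ) :
    (x + y) ⬝ᵥ (P *ᵥ (x + y)) ≤
      (1 + φ) * (x ⬝ᵥ (P *ᵥ x)) + (φ + 1) / φ * (y ⬝ᵥ (P *ᵥ y)) := by
  have hnonneg : 0 ≤ (φ • x - y) ⬝ᵥ (P *ᵥ (φ • x - y)) := by
    simpa using hP.dotProduct_mulVec_nonneg (φ • x - y)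
  simp only [mulVec_sub, mulVec_smul, sub_dotProduct, dotProduct_sub, smul_dotProduct,
    dotProduct_smul, smul_eq_mul] at hnonneg
  simp only [mulVec_add, add_dotProduct, dotProduct_add]
  refine le_of_mul_le_mul_left ?_ hφ
  have hcancel : φ * ((φ + 1) / φ * (y ⬝ᵥ (P *ᵥ y))) = (φ + 1) * (y ⬝ᵥ (P *ᵥ y)) := by
    field_simp
  rw [mul_add φ ((1 + φ) * _), hcancel]
  linarith

/-- The semidefinite inequality `(1 + φ) AᵀPA ≤ α P`, evaluated at a vector. -/
theorem Matrix.PosSemidef.quadratic_mulVec_le {ι : Type*} [Fintype ι] {P A : Matrix ι ι ℝ}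
    {α φ : ℝ} (hLMI : (α • P - (1 + φ) • (Aᵀ * P * A)).PosSemidef) (x : ι → ℝ) :
    (1 + φ) * ((A *ᵥ x) ⬝ᵥ (P *ᵥ (A *ᵥ x))) ≤ α * (x ⬝ᵥ (P *ᵥ x)) := by
  have hnonneg := hLMI.dotProduct_mulVec_nonneg x
  have hcongr : x ⬝ᵥ ((Aᵀ * P * A) *ᵥ x) = (A *ᵥ x) ⬝ᵥ (P *ᵥ (A *ᵥ x)) := by
    rw [Matrix.mul_assoc, ← mulVec_mulVec, ← mulVec_mulVec, dotProduct_mulVec, vecMul_transpose]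
  simp only [star_trivial, sub_mulVec, smul_mulVec, dotProduct_sub, dotProduct_smul, smul_eq_mul,
    hcongr] at hnonneg
  linarith

/-- A sequence starting below `1` that satisfies `v (t + 1) ≤ α v t + c` whenever `v t ≤ 1` drops
below any level exceeding the fixed point `c / (1 - α) ≤ 1`. -/
theorem exists_lt_of_affine_contraction {v : ℕ → ℝ} {α c b : ℝ} (hα : α ∈ Set.Ioo (0 : ℝ) 1)
    (hc : 0 ≤ c) (hsum : α + c ≤ 1) (hb : c / (1 - α) < b) (h0 : v 0 ≤ 1)
    (hstep : ∀ t, v t ≤ 1 → v (t + 1) ≤ α * v t + c) : ∃ t, v t < b := by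
  obtain ⟨hα0, hα1⟩ := hα
  have hbound : ∀ t, v t ≤ 1 := by
    intro t
    induction t with
    | zero => exact h0
    | succ t ih => nlinarith [hstep t ih]
  set d := c / (1 - α) with hd
  have hd0 : 0 ≤ d := div_nonneg hc (by linarith)
  have hfix : c = (1 - α) * d := by
    rw [hd, mul_div_cancel₀ _ (by linarith : 1 - α ≠ 0)]
  have hdecay : ∀ t, v t - d ≤ α ^ t := by
    intro t
    induction t with
    | zero => simpa using by linarith
    | succ t ih =>
      rw [pow_succ']
      nlinarith [hstep t (hbound t), mul_le_mul_of_nonneg_left ih hα0.le]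
  obtain ⟨t, ht⟩ := exists_pow_lt_of_lt_one (sub_pos.2 hb) hα1
  exact ⟨t, by linarith [hdecay t]⟩

/-- Eventual return to a smaller ellipsoid: under the one-step decrease LMI and a
bounded mismatch, the Lyapunov value eventually drops below any `b` exceeding the
asymptotic bound `(φ+1) κ / ((1-α) φ)`. -/
theorem eventual_return_to_sublevel {n : ℕ}
    (P : Matrix (Fin n) (Fin n) ℝ) (hP : P.PosDef)
    (Abar : Matrix (Fin n) (Fin n) ℝ) (h : (Fin n → ℝ) → (Fin n → ℝ))
    (α φ κ b : ℝ) (hα : α ∈ Set.Ioo (0 : ℝ) 1) (hφ : 0 < φ) (hκ : 0 < κ) (hb : 0 < b)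
    (hsum : α + (φ + 1) * κ / φ ≤ 1)
    (hbb : (φ + 1) * κ / ((1 - α) * φ) < b)
    (hLMI : (α • P - (1 + φ) • (Abarᵀ * P * Abar)).PosDef)
    (hh : ∀ e : Fin n → ℝ, e ⬝ᵥ (P *ᵥ e) ≤ 1 → (h e) ⬝ᵥ (P *ᵥ (h e)) ≤ κ)
    (e : ℕ → Fin n → ℝ) (hdyn : ∀ t, e (t + 1) = Abar *ᵥ e t + h (e t))
    (h0 : (e 0) ⬝ᵥ (P *ᵥ (e 0)) < 1) :
    ∃ τ : ℕ, (e τ) ⬝ᵥ (P *ᵥ (e τ)) < b := by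
  refine exists_lt_of_affine_contraction (v := fun t => e t ⬝ᵥ (P *ᵥ e t))
    (c := (φ + 1) * κ / φ) hα (by positivity) hsum ?_ h0.le fun t ht => ?_
  · rwa [div_div, mul_comm φ]
  · have hmismatch : (φ + 1) / φ * (h (e t) ⬝ᵥ (P *ᵥ h (e t))) ≤ (φ + 1) * κ / φ := by
      rw [mul_div_right_comm]
      exact mul_le_mul_of_nonneg_left (hh _ ht) (by positivity)
    simp only [hdyn t]
    linarith [hP.posSemidef.quadratic_add_le hφ (Abar *ᵥ e t) (h (e t)),
      hLMI.posSemidef.quadratic_mulVec_le (e t)]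
end

section
/- Let C be a p×n real matrix, let c ∈ ℝᵖ be a vector with all entries strictly positive, let θ > 0 and γ > 0 be reals, let P be an n×n real positive definite matrix, and let s* ∈ ℝⁿ. Set C̄ = C·diag(θ·c)⁻¹. If the matrix I_p − C̄·P⁻¹·C̄ᵀ is positive definite, then the scaled ellipsoid { s ∈ ℝⁿ : (s − s*)ᵀ·P·(s − s*) ≤ γ²/θ² } is contained in the set { s ∈ ℝⁿ : −γ·c ≤ C·(s − s*) ≤ γ·c entrywise }. -/
open Matrix

namespace Matrix

variable {m : Type*} [Fintype m]

/-- Cauchy–Schwarz for the inner product of a real positive semidefinite matrix. -/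
theorem PosSemidef.sq_dotProduct_mulVec_le_s15 [DecidableEq m] {P : Matrix m m ℝ}
    (hP : P.PosSemidef) (x y : m → ℝ) :
    (x ⬝ᵥ (P *ᵥ y)) ^ 2 ≤ (x ⬝ᵥ (P *ᵥ x)) * (y ⬝ᵥ (P *ᵥ y)) := by
  have hsymm : Pᵀ = P := by simpa using hP.isHermitian.eq
  have hB : LinearMap.IsSymm (toBilin' P) := ⟨fun u v => by
    simp only [toBilin'_apply', RingHom.id_apply]
    rw [dotProduct_mulVec, ← mulVec_transpose, hsymm, dotProduct_comm]⟩
  have h := LinearMap.BilinForm.apply_sq_le_of_symm (toBilin' P)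
    (fun u => by simpa [toBilin'_apply'] using hP.dotProduct_mulVec_nonneg u) hB x y
  simpa only [toBilin'_apply'] using h

/-- Cauchy–Schwarz for the dual pair of norms given by a real positive definite matrix and its
inverse. -/
theorem PosDef.sq_dotProduct_le_s15 [DecidableEq m] {P : Matrix m m ℝ} (hP : P.PosDef)
    (r x : m → ℝ) :
    (r ⬝ᵥ x) ^ 2 ≤ (r ⬝ᵥ (P⁻¹ *ᵥ r)) * (x ⬝ᵥ (P *ᵥ x)) := by
  have hr : P *ᵥ (P⁻¹ *ᵥ r) = r := by
    rw [mulVec_mulVec, mul_nonsing_inv P ((isUnit_iff_isUnit_det P).1 hP.isUnit), one_mulVec]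
  have h := hP.posSemidef.sq_dotProduct_mulVec_le_s15 x (P⁻¹ *ᵥ r)
  rw [hr, dotProduct_comm (P⁻¹ *ᵥ r), dotProduct_comm x r, mul_comm] at h
  exact h

end Matrix

/-- If `I - C̄ P⁻¹ C̄ᵀ ≻ 0` with `C̄ = C diag(θ c)⁻¹`, then the scaled ellipsoid
`{s | (s-s*)ᵀ P (s-s*) ≤ γ²/θ²}` is contained in
`{s | -γ c ≤ C (s-s*) ≤ γ c entrywise}`. -/
theorem scaled_ellipsoid_subset {p n : ℕ}
    (C : Matrix (Fin p) (Fin n) ℝ) (c : Fin p → ℝ) (hc : ∀ i, 0 < c i)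
    (θ γ : ℝ) (hθ : 0 < θ) (hγ : 0 < γ)
    (P : Matrix (Fin n) (Fin n) ℝ) (hP : P.PosDef) (sstar : Fin n → ℝ)
    (h : ((1 : Matrix (Fin p) (Fin p) ℝ) -
        ((Matrix.diagonal (θ • c))⁻¹ * C) * P⁻¹ *
          ((Matrix.diagonal (θ • c))⁻¹ * C)ᵀ).PosDef) :
    {s : Fin n → ℝ | (s - sstar) ⬝ᵥ (P *ᵥ (s - sstar)) ≤ γ ^ 2 / θ ^ 2} ⊆
      {s : Fin n → ℝ | ∀ i, -(γ * c i) ≤ (C *ᵥ (s - sstar)) i ∧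
        (C *ᵥ (s - sstar)) i ≤ γ * c i} := by
  intro s hs i
  simp only [Set.mem_ofPred_eq] at hs
  set x := s - sstar
  set D := (Matrix.diagonal (θ • c))⁻¹ * C with hD
  have hθc : 0 < θ * c i := mul_pos hθ (hc i)
  have hrow : C *ᵥ x = Matrix.diagonal (θ • c) *ᵥ (D *ᵥ x) := by
    rw [hD, Matrix.mulVec_mulVec, Matrix.mul_nonsing_inv_cancel_left]
    rw [Matrix.det_diagonal, isUnit_iff_ne_zero]
    exact Finset.prod_ne_zero_iff.2 fun j _ => (mul_pos hθ (hc j)).ne'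
  have hCx : (C *ᵥ x) i = θ * c i * (D i ⬝ᵥ x) := by
    rw [hrow, Matrix.mulVec_diagonal]
    rfl
  have hq : D i ⬝ᵥ (P⁻¹ *ᵥ D i) < 1 := by
    have hdiag := h.diag_pos (i := i)
    have hentry : (D * P⁻¹ * Dᵀ) i i = D i ⬝ᵥ (P⁻¹ *ᵥ D i) := by
      rw [Matrix.mul_assoc]
      rfl
    rw [Matrix.sub_apply, Matrix.one_apply_eq, hentry] at hdiag
    linarith
  have hx : 0 ≤ x ⬝ᵥ (P *ᵥ x) := by
    simpa using hP.posSemidef.dotProduct_mulVec_nonneg x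
  have hsq : (D i ⬝ᵥ x) ^ 2 ≤ (γ / θ) ^ 2 := by
    rw [div_pow]
    exact ((hP.sq_dotProduct_le_s15 (D i) x).trans (mul_le_of_le_one_left hx hq.le)).trans hs
  have habs : |(C *ᵥ x) i| ≤ γ * c i := by
    rw [hCx, abs_mul, abs_of_pos hθc]
    calc θ * c i * |D i ⬝ᵥ x| ≤ θ * c i * (γ / θ) :=
          mul_le_mul_of_nonneg_left (abs_le_of_sq_le_sq hsq (by positivity)) hθc.le
      _ = γ * c i := by field_simp
  exact abs_le.1 habs
end

section
/- Let Q be an n×n real positive definite matrix, T an m×m real positive definite matrix, and F an m×n real matrix. If the matrix Q⁻¹ − Fᵀ·T⁻¹·F is positive definite, then for every e ∈ ℝⁿ with eᵀ·Q⁻¹·e < 1, the action a = F·e satisfies aᵀ·T⁻¹·a < 1. -/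
open Matrix

/-- If `Q⁻¹ - Fᵀ T⁻¹ F ≻ 0`, then for every `e` with `eᵀ Q⁻¹ e < 1`,
the action `a = F e` satisfies `aᵀ T⁻¹ a < 1`. -/
theorem action_in_ellipsoid {n m : ℕ}
    (Q : Matrix (Fin n) (Fin n) ℝ) (hQ : Q.PosDef)
    (T : Matrix (Fin m) (Fin m) ℝ) (hT : T.PosDef)
    (F : Matrix (Fin m) (Fin n) ℝ)
    (h : (Q⁻¹ - Fᵀ * T⁻¹ * F).PosDef) :
    ∀ e : Fin n → ℝ, e ⬝ᵥ (Q⁻¹ *ᵥ e) < 1 →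
      (F *ᵥ e) ⬝ᵥ (T⁻¹ *ᵥ (F *ᵥ e)) < 1 := by
  intro e he
  have h_nonneg : 0 ≤ star e ⬝ᵥ ((Q⁻¹ - Fᵀ * T⁻¹ * F) *ᵥ e) :=
    h.posSemidef.dotProduct_mulVec_nonneg e
  have h_quad : e ⬝ᵥ ((Fᵀ * T⁻¹ * F) *ᵥ e) = (F *ᵥ e) ⬝ᵥ (T⁻¹ *ᵥ (F *ᵥ e)) := by
    rw [← mulVec_mulVec, ← mulVec_mulVec, dotProduct_mulVec, vecMul_transpose]
  rw [star_trivial, sub_mulVec, dotProduct_sub, h_quad] at h_nonneg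
  linarith
end
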